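/- arXiv:math/0306101 — 2 statements merged into one kernel-verified Lean document; each statement's English description precedes it below -/
import Mathlib

section
/- For every complex number s and every natural number k, the function w ↦ ∫₁^∞ e^{-wy} y^{s-1} dy is analytic on the half-plane { w ∈ ℂ : Re(w) > 0 }, and its k-th derivative at any point w with Re(w) > 0 equals (-1)^k ∫₁^∞ e^{-wy} y^{s+k-1} dy; in particular the k-th derivative of x ↦ G(s,x) at real x > 0 is (-1)^k G(s+k,x). -/
open MeasureTheory

/-- `G s w = ∫₁^∞ e^{-wy} y^{s-1} dy` for complex `w`. -/
noncomputable def G (s w : ℂ) : ℂ :=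
  ∫ y in Set.Ioi (1 : ℝ), Complex.exp (-(w * y)) * (y : ℂ) ^ (s - 1)

lemma bound_int (a b : ℝ) (hb : 0 < b) :
    Integrable (fun y : ℝ => y ^ (max a 0) * Real.exp (-b * y))
      (volume.restrict (Set.Ioi (1 : ℝ))) := by
  have h := integrableOn_rpow_mul_exp_neg_mul_rpow (p := 1) (s := max a 0) (b := b)
    (by linarith [le_max_right a 0]) one_pos hb
  simp only [Real.rpow_one] at h
  exact h.mono_set (Set.Ioi_subset_Ioi zero_le_one)

lemma norm_bound (s w : ℂ) (b y : ℝ) (hy : 1 < y) (hw : b ≤ w.re) :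
    ‖Complex.exp (-(w * y)) * (y : ℂ) ^ s‖ ≤ y ^ (max s.re 0) * Real.exp (-b * y) := by
  have hy0 : 0 < y := by linarith
  rw [norm_mul, Complex.norm_exp, Complex.norm_cpow_eq_rpow_re_of_pos hy0, mul_comm]
  gcongr
  · exact hy.le
  · exact le_max_left _ _
  · simp
    nlinarith

lemma meas_aux (s w : ℂ) :
    AEStronglyMeasurable (fun y : ℝ => Complex.exp (-(w * y)) * (y : ℂ) ^ s)
      (volume.restrict (Set.Ioi (1 : ℝ))) := by
  apply Measurable.aestronglyMeasurable
  fun_prop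

lemma G_hasDerivAt (s w : ℂ) (hw : 0 < w.re) :
    HasDerivAt (fun w : ℂ => G s w) (-G (s + 1) w) w := by
  have hopen : {z : ℂ | w.re / 2 < z.re} ∈ nhds w :=
    (isOpen_lt continuous_const Complex.continuous_re).mem_nhds
      (by simp only [Set.mem_ofPred_eq]; linarith)
  have key := hasDerivAt_integral_of_dominated_loc_of_deriv_le
    (μ := volume.restrict (Set.Ioi (1 : ℝ)))
    (F := fun (w : ℂ) (y : ℝ) => Complex.exp (-(w * y)) * (y : ℂ) ^ (s - 1))
    (F' := fun (w : ℂ) (y : ℝ) => -(Complex.exp (-(w * y)) * (y : ℂ) ^ s))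
    (bound := fun y : ℝ => y ^ (max s.re 0) * Real.exp (-(w.re / 2) * y))
    hopen (Filter.Eventually.of_forall fun z => meas_aux _ z) ?_ (meas_aux s w).neg ?_
    (bound_int _ _ (by linarith)) ?_
  · have h2 := key.2
    rw [integral_neg] at h2
    simpa [G] using h2
  · refine (bound_int (s - 1).re w.re hw).mono' (meas_aux _ _) ?_
    filter_upwards [ae_restrict_mem measurableSet_Ioi] with y hy
    exact norm_bound _ _ _ _ hy le_rfl
  · filter_upwards [ae_restrict_mem measurableSet_Ioi] with y hy z hz
    rw [norm_neg]
    exact norm_bound _ _ _ _ hy (le_of_lt hz)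
  · filter_upwards [ae_restrict_mem measurableSet_Ioi] with y hy z hz
    have hy0 : (y : ℂ) ≠ 0 := by
      have : (1 : ℝ) < y := hy
      exact_mod_cast (by linarith : (0 : ℝ) < y).ne'
    have h1 : HasDerivAt (fun z : ℂ => -(z * (y : ℂ))) (-(1 * (y : ℂ))) z :=
      ((hasDerivAt_id z).mul_const (y : ℂ)).neg
    have h := h1.cexp.mul_const ((y : ℂ) ^ (s - 1))
    refine h.congr_deriv ?_
    rw [Complex.cpow_sub _ _ hy0, Complex.cpow_one]
    field_simp

lemma G_iter (s : ℂ) (k : ℕ) : ∀ w : ℂ, 0 < w.re →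
    iteratedDeriv k (fun w : ℂ => G s w) w = (-1 : ℂ) ^ k * G (s + k) w := by
  induction k with
  | zero => intro w _; simp
  | succ k ih =>
    intro w hw
    rw [iteratedDeriv_succ]
    have he : iteratedDeriv k (fun w : ℂ => G s w) =ᶠ[nhds w]
        fun w => (-1 : ℂ) ^ k * G (s + k) w := by
      filter_upwards [(isOpen_lt continuous_const Complex.continuous_re).mem_nhds hw] with z hz
      exact ih z hz
    rw [he.deriv_eq, ((G_hasDerivAt (s + k) w hw).const_mul _).deriv]
    push_cast
    rw [← add_assoc]
    ring

theorem stmt_3 (s : ℂ) (k : ℕ) :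
    AnalyticOnNhd ℂ (fun w : ℂ => G s w) {w : ℂ | 0 < w.re} ∧
    (∀ w : ℂ, 0 < w.re →
      iteratedDeriv k (fun w : ℂ => G s w) w = (-1 : ℂ) ^ k * G (s + k) w) ∧
    (∀ x : ℝ, 0 < x →
      iteratedDeriv k (fun w : ℂ => G s w) (x : ℂ) = (-1 : ℂ) ^ k * G (s + k) (x : ℂ)) := by
  refine ⟨?_, G_iter s k, fun x hx => G_iter s k x (by simpa using hx)⟩
  refine DifferentiableOn.analyticOnNhd (fun w hw => ?_)
    (isOpen_lt continuous_const Complex.continuous_re)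
  exact (G_hasDerivAt s w hw).differentiableAt.differentiableWithinAt
end

section
/- Let a, b, c be real numbers with a ≥ 1 and |b| ≤ a ≤ c, set q := 4ac - b², let L > 0 be real, and set N := q^{1/2}·L/(2π). Then for all real x, y with ax² + bxy + cy² ≤ N, one has |x| ≤ q^{1/4}·L^{1/2} and |y| ≤ (2/3^{1/4})·L^{1/2}. -/
open Real

lemma quarter_sq (t : ℝ) (ht : 0 ≤ t) : (t ^ (1 / 4 : ℝ)) ^ 2 = Real.sqrt t := by
  rw [← Real.rpow_natCast, ← Real.rpow_mul ht, Real.sqrt_eq_rpow]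
  norm_num

lemma half_sq (t : ℝ) (ht : 0 ≤ t) : (t ^ (1 / 2 : ℝ)) ^ 2 = t := by
  rw [← Real.sqrt_eq_rpow, Real.sq_sqrt ht]

theorem stmt_19 (a b c q L N : ℝ) (ha : 1 ≤ a) (hb : |b| ≤ a) (hac : a ≤ c)
    (hq : q = 4 * a * c - b ^ 2) (hL : 0 < L) (hN : N = Real.sqrt q * L / (2 * π)) :
    ∀ x y : ℝ, a * x ^ 2 + b * x * y + c * y ^ 2 ≤ N →
      |x| ≤ q ^ (1 / 4 : ℝ) * L ^ (1 / 2 : ℝ) ∧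
      |y| ≤ 2 / (3 : ℝ) ^ (1 / 4 : ℝ) * L ^ (1 / 2 : ℝ) := by
  intro x y h
  have hb2 : b ^ 2 ≤ a ^ 2 := sq_le_sq' (by linarith [(abs_le.mp hb).1]) (abs_le.mp hb).2
  have hq1 : 3 * (a * c) ≤ q := by nlinarith
  have hqc : 3 * c ≤ q := by nlinarith
  have hqa : 3 * a ^ 2 ≤ q := by nlinarith
  have hq0 : 0 < q := by linarith
  have hs0 : 0 < Real.sqrt q := Real.sqrt_pos.mpr hq0
  have hss : Real.sqrt q ^ 2 = q := Real.sq_sqrt hq0.le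
  have h30 : 0 < Real.sqrt 3 := Real.sqrt_pos.mpr (by norm_num)
  have h3s : Real.sqrt 3 ^ 2 = 3 := Real.sq_sqrt (by norm_num)
  have hsa : Real.sqrt 3 * a ≤ Real.sqrt q := by
    apply Real.le_sqrt_of_sq_le
    rw [mul_pow, h3s]; exact hqa
  have hN6 : N ≤ Real.sqrt q * L / 6 := by
    rw [hN]
    apply div_le_div_of_nonneg_left (by positivity) (by norm_num)
    linarith [Real.pi_gt_three]
  have hsL : 0 < Real.sqrt q * L := by positivity
  have hF := h.trans hN6
  set s := Real.sqrt q with hs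
  constructor
  · apply abs_le_of_sq_le_sq _ (by positivity)
    rw [mul_pow, quarter_sq q hq0.le, half_sq L hL.le, ← hs]
    have h1 : q * x ^ 2 ≤ 4 * c * (s * L / 6) := by
      have := mul_le_mul_of_nonneg_left hF (by linarith : 0 ≤ 4 * c)
      nlinarith [sq_nonneg (2 * c * y + b * x)]
    have h2 : 3 * c * (s * L) ≤ q * (s * L) := mul_le_mul_of_nonneg_right hqc hsL.le
    have h3 : 0 < c * (s * L) := mul_pos (by linarith) hsL
    exact le_of_mul_le_mul_left (by linarith) hq0
  · apply abs_le_of_sq_le_sq _ (by positivity)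
    rw [mul_pow, div_pow, quarter_sq 3 (by norm_num), half_sq L hL.le, div_mul_eq_mul_div,
      le_div_iff₀ h30]
    have h1 : q * y ^ 2 ≤ 4 * a * (s * L / 6) := by
      have := mul_le_mul_of_nonneg_left hF (by linarith : 0 ≤ 4 * a)
      nlinarith [sq_nonneg (2 * a * x + b * y)]
    have h2 : s * y ^ 2 ≤ 4 * a * (L / 6) := by
      apply le_of_mul_le_mul_left _ hs0
      rw [← hss] at h1
      linarith
    have h3 := mul_le_mul_of_nonneg_right hsa hL.le
    have h4 := mul_le_mul_of_nonneg_right h2 h30.le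
    exact le_of_mul_le_mul_left (by linarith) hs0
end
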